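/- Let f : [A,B] → ℝ be C² with f' > 0 and f'' α-Hölder on [A,B]. Then there exists a constant K such that for all pairwise distinct x1, x2, x3, x4 ∈ [A,B], |Dist(x1,x2,x3,x4;f) − 1| ≤ K·|x1−x3|·Δ^α, where Δ = max{x1,x2,x3,x4} − min{x1,x2,x3,x4}. -/

import Mathlib

/-- Cross-ratio of four reals. -/
noncomputable def Cr (a b c d : ℝ) : ℝ := ((a - b) * (c - d)) / ((b - c) * (d - a))

/-- Cross-ratio distortion of four points with respect to `f`. -/
noncomputable def crossDist (f : ℝ → ℝ) (x1 x2 x3 x4 : ℝ) : ℝ :=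
  Cr (f x1) (f x2) (f x3) (f x4) / Cr x1 x2 x3 x4

theorem dd_sorted {f f' f'' : ℝ → ℝ} {a b c : ℝ} (hab : a < b) (hbc : b < c)
    (hd1 : ∀ x ∈ Set.Icc a c, HasDerivAt f (f' x) x)
    (hd2 : ∀ x ∈ Set.Icc a c, HasDerivAt f' (f'' x) x) :
    ∃ ξ ∈ Set.Icc a c, f a * (b - c) + f b * (c - a) + f c * (a - b)
      = -(f'' ξ / 2) * ((a - b) * (b - c) * (c - a)) := by
  obtain ⟨s, hs⟩ : ∃ s, s = (f b - f a) / (b - a) := ⟨_, rfl⟩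
  obtain ⟨D, hD⟩ : ∃ D, D = (f c - f a - s * (c - a)) / ((c - a) * (c - b)) := ⟨_, rfl⟩
  have h1 : b - a ≠ 0 := by linarith
  have h2 : c - a ≠ 0 := by linarith
  have h3 : c - b ≠ 0 := by linarith
  have es : s * (b - a) = f b - f a := by rw [hs]; field_simp
  have eD : D * ((c - a) * (c - b)) = f c - f a - s * (c - a) := by rw [hD]; field_simp
  let g : ℝ → ℝ := fun x => f x - f a - s * (x - a) - D * ((x - a) * (x - b))
  let g' : ℝ → ℝ := fun x => f' x - s - D * ((x - b) + (x - a))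
  have hg : ∀ x ∈ Set.Icc a c, HasDerivAt g (g' x) x := by
    intro x hx
    have ia := (hasDerivAt_id x).sub_const a
    have ib := (hasDerivAt_id x).sub_const b
    have := (((hd1 x hx).sub_const (f a)).sub (ia.const_mul s)).sub ((ia.mul ib).const_mul D)
    refine this.congr_deriv ?_
    simp [g']
  have hg' : ∀ x ∈ Set.Icc a c, HasDerivAt g' (f'' x - 2 * D) x := by
    intro x hx
    have ia := (hasDerivAt_id x).sub_const a
    have ib := (hasDerivAt_id x).sub_const b
    have := ((hd2 x hx).sub_const s).sub ((ib.add ia).const_mul D)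
    refine this.congr_deriv ?_
    ring
  have ga : g a = 0 := by simp [g]
  have gb : g b = 0 := by simp only [g]; linear_combination -es
  have gc : g c = 0 := by simp only [g]; linear_combination -eD
  obtain ⟨u, hu, gu⟩ := exists_hasDerivAt_eq_zero (f := g) (f' := g') hab
    (fun x hx => (hg x ⟨hx.1, by linarith [hx.2]⟩).continuousAt.continuousWithinAt)
    (by rw [ga, gb]) (fun x hx => hg x ⟨hx.1.le, by linarith [hx.2]⟩)
  obtain ⟨v, hv, gv⟩ := exists_hasDerivAt_eq_zero (f := g) (f' := g') hbc
    (fun x hx => (hg x ⟨by linarith [hx.1], hx.2⟩).continuousAt.continuousWithinAt)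
    (by rw [gc, gb]) (fun x hx => hg x ⟨by linarith [hx.1], hx.2.le⟩)
  have huv : u < v := hu.2.trans hv.1
  obtain ⟨w, hw, gw⟩ := exists_hasDerivAt_eq_zero (f := g') (f' := fun x => f'' x - 2 * D) huv
    (fun x hx => (hg' x ⟨by linarith [hx.1, hu.1], by linarith [hx.2, hv.2]⟩).continuousAt.continuousWithinAt)
    (by rw [gu, gv]) (fun x hx => hg' x ⟨by linarith [hx.1, hu.1], by linarith [hx.2, hv.2]⟩)
  refine ⟨w, ⟨by linarith [hw.1, hu.1], by linarith [hw.2, hv.2]⟩, ?_⟩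
  have : f'' w / 2 = D := by linarith
  rw [this]
  linear_combination (b - a) * eD - (c - a) * es

theorem dd_any {f f' f'' : ℝ → ℝ} {L U a b c : ℝ} (hab : a ≠ b) (hbc : b ≠ c) (hac : a ≠ c)
    (ha : a ∈ Set.Icc L U) (hb : b ∈ Set.Icc L U) (hc : c ∈ Set.Icc L U)
    (hd1 : ∀ x ∈ Set.Icc L U, HasDerivAt f (f' x) x)
    (hd2 : ∀ x ∈ Set.Icc L U, HasDerivAt f' (f'' x) x) :
    ∃ ξ ∈ Set.Icc L U, f a * (b - c) + f b * (c - a) + f c * (a - b)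
      = -(f'' ξ / 2) * ((a - b) * (b - c) * (c - a)) := by
  have key : ∀ p ∈ Set.Icc L U, ∀ q ∈ Set.Icc L U, ∀ r ∈ Set.Icc L U, p < q → q < r →
      ∃ ξ ∈ Set.Icc L U, f p * (q - r) + f q * (r - p) + f r * (p - q)
      = -(f'' ξ / 2) * ((p - q) * (q - r) * (r - p)) := by
    intro p hp q hq r hr h1 h2
    have hs : Set.Icc p r ⊆ Set.Icc L U := Set.Icc_subset_Icc hp.1 hr.2
    obtain ⟨ξ, h, e⟩ := dd_sorted h1 h2 (fun x hx => hd1 x (hs hx)) (fun x hx => hd2 x (hs hx))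
    exact ⟨ξ, hs h, e⟩
  rcases lt_or_gt_of_ne hab with h1 | h1 <;> rcases lt_or_gt_of_ne hbc with h2 | h2 <;>
    rcases lt_or_gt_of_ne hac with h3 | h3
  · exact key a ha b hb c hc h1 h2
  · linarith
  · obtain ⟨ξ, h, e⟩ := key a ha c hc b hb h3 h2
    exact ⟨ξ, h, by linear_combination -e⟩
  · obtain ⟨ξ, h, e⟩ := key c hc a ha b hb h3 h1
    exact ⟨ξ, h, by linear_combination e⟩
  · obtain ⟨ξ, h, e⟩ := key b hb a ha c hc h1 h3
    exact ⟨ξ, h, by linear_combination -e⟩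
  · obtain ⟨ξ, h, e⟩ := key b hb c hc a ha h2 h3
    exact ⟨ξ, h, by linear_combination e⟩
  · linarith
  · obtain ⟨ξ, h, e⟩ := key c hc b hb a ha h2 h1
    exact ⟨ξ, h, by linear_combination -e⟩

theorem dd_diff {f f' f'' : ℝ → ℝ} {L U a b c p r : ℝ} (hab : a ≠ b) (hbc : b ≠ c) (hac : a ≠ c)
    (ha : a ∈ Set.Icc L U) (hb : b ∈ Set.Icc L U) (hc : c ∈ Set.Icc L U)
    (hd1 : ∀ x ∈ Set.Icc L U, HasDerivAt f (f' x) x)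
    (hd2 : ∀ x ∈ Set.Icc L U, HasDerivAt f' (f'' x) x)
    (hp : f a - f b = p * (a - b)) (hr : f c - f b = r * (c - b)) :
    ∃ ξ ∈ Set.Icc L U, p - r = (a - c) * (f'' ξ / 2) := by
  obtain ⟨ξ, h, e⟩ := dd_any hab hbc hac ha hb hc hd1 hd2
  refine ⟨ξ, h, ?_⟩
  have hne : (a - b) * (b - c) ≠ 0 := mul_ne_zero (sub_ne_zero.2 hab) (sub_ne_zero.2 hbc)
  apply mul_left_cancel₀ hne
  linear_combination e - (b - c) * hp - (a - b) * hr

theorem mvt_any {f f' : ℝ → ℝ} {L U a b : ℝ} (hab : a ≠ b)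
    (ha : a ∈ Set.Icc L U) (hb : b ∈ Set.Icc L U)
    (hd1 : ∀ x ∈ Set.Icc L U, HasDerivAt f (f' x) x) :
    ∃ ξ ∈ Set.Icc L U, f a - f b = f' ξ * (a - b) := by
  have key : ∀ p ∈ Set.Icc L U, ∀ q ∈ Set.Icc L U, p < q →
      ∃ ξ ∈ Set.Icc L U, f q - f p = f' ξ * (q - p) := by
    intro p hp q hq h
    have hs : Set.Icc p q ⊆ Set.Icc L U := Set.Icc_subset_Icc hp.1 hq.2
    obtain ⟨ξ, h1, e⟩ := exists_hasDerivAt_eq_slope f f' h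
      (fun x hx => (hd1 x (hs hx)).continuousAt.continuousWithinAt)
      (fun x hx => hd1 x (hs (Set.Ioo_subset_Icc_self hx)))
    refine ⟨ξ, hs (Set.Ioo_subset_Icc_self h1), ?_⟩
    have : q - p ≠ 0 := by linarith
    rw [e]; field_simp
  rcases lt_or_gt_of_ne hab with h | h
  · obtain ⟨ξ, h, e⟩ := key a ha b hb h
    exact ⟨ξ, h, by linear_combination -e⟩
  · exact key b hb a ha h

theorem crossDist_estimate
    (A B : ℝ) (hAB : A < B) (f f' f'' : ℝ → ℝ) (α H : ℝ) (hα : α ∈ Set.Ioc (0:ℝ) 1)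
    (hH : 0 ≤ H)
    (hd1 : ∀ x ∈ Set.Icc A B, HasDerivAt f (f' x) x)
    (hd2 : ∀ x ∈ Set.Icc A B, HasDerivAt f' (f'' x) x)
    (hcont : ContinuousOn f'' (Set.Icc A B))
    (hpos : ∀ x ∈ Set.Icc A B, 0 < f' x)
    (hHolder : ∀ x ∈ Set.Icc A B, ∀ y ∈ Set.Icc A B, |f'' x - f'' y| ≤ H * |x - y| ^ α) :
    ∃ K > 0, ∀ x1 ∈ Set.Icc A B, ∀ x2 ∈ Set.Icc A B, ∀ x3 ∈ Set.Icc A B, ∀ x4 ∈ Set.Icc A B,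
      x1 ≠ x2 → x1 ≠ x3 → x1 ≠ x4 → x2 ≠ x3 → x2 ≠ x4 → x3 ≠ x4 →
      |crossDist f x1 x2 x3 x4 - 1| ≤
        K * |x1 - x3| *
          (max (max x1 x2) (max x3 x4) - min (min x1 x2) (min x3 x4)) ^ α := by
  have hα0 := hα.1
  have hα1 := hα.2
  have hc1 : ContinuousOn f' (Set.Icc A B) :=
    fun x hx => (hd2 x hx).continuousAt.continuousWithinAt
  have hne : (Set.Icc A B).Nonempty := Set.nonempty_Icc.2 hAB.le
  obtain ⟨x0, hx0, hmin⟩ := isCompact_Icc.exists_isMinOn hne hc1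
  obtain ⟨m, hm⟩ : ∃ m, m = f' x0 := ⟨_, rfl⟩
  have hm0 : 0 < m := hm ▸ hpos x0 hx0
  have hmle : ∀ x ∈ Set.Icc A B, m ≤ f' x := fun x hx => hm ▸ hmin hx
  obtain ⟨N, hN⟩ := isCompact_Icc.exists_bound_of_continuousOn hc1
  obtain ⟨M, hM⟩ := isCompact_Icc.exists_bound_of_continuousOn hcont
  simp only [Real.norm_eq_abs] at hN hM
  have hN0 : 0 ≤ N := (abs_nonneg _).trans (hN x0 hx0)
  have hM0 : 0 ≤ M := (abs_nonneg _).trans (hM x0 hx0)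
  obtain ⟨E, hE⟩ : ∃ E, E = (B - A) ^ (1 - α) := ⟨_, rfl⟩
  have hE0 : 0 ≤ E := hE ▸ Real.rpow_nonneg (by linarith) _
  refine ⟨(M * M * E + N * H) / m ^ 2 + 1, by positivity, ?_⟩
  intro x1 hx1 x2 hx2 x3 hx3 x4 hx4 h12 h13 h14 h23 h24 h34
  obtain ⟨L, hL⟩ : ∃ L, L = min (min x1 x2) (min x3 x4) := ⟨_, rfl⟩
  obtain ⟨U, hU⟩ : ∃ U, U = max (max x1 x2) (max x3 x4) := ⟨_, rfl⟩
  rw [← hL, ← hU]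
  have i1 : x1 ∈ Set.Icc L U := by rw [hL, hU]; constructor <;> simp
  have i2 : x2 ∈ Set.Icc L U := by rw [hL, hU]; constructor <;> simp
  have i3 : x3 ∈ Set.Icc L U := by rw [hL, hU]; constructor <;> simp
  have i4 : x4 ∈ Set.Icc L U := by rw [hL, hU]; constructor <;> simp
  have hAL : A ≤ L := by
    rw [hL]; exact le_min (le_min hx1.1 hx2.1) (le_min hx3.1 hx4.1)
  have hUB : U ≤ B := by
    rw [hU]; exact max_le (max_le hx1.2 hx2.2) (max_le hx3.2 hx4.2)
  have hs : Set.Icc L U ⊆ Set.Icc A B := Set.Icc_subset_Icc hAL hUB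
  have hd1' : ∀ x ∈ Set.Icc L U, HasDerivAt f (f' x) x := fun x hx => hd1 x (hs hx)
  have hd2' : ∀ x ∈ Set.Icc L U, HasDerivAt f' (f'' x) x := fun x hx => hd2 x (hs hx)
  have hLU : 0 < U - L := by
    rcases lt_or_gt_of_ne h12 with h | h <;> linarith [i1.1, i1.2, i2.1, i2.2]
  have hdist : ∀ x ∈ Set.Icc L U, ∀ y ∈ Set.Icc L U, |x - y| ≤ U - L := by
    intro x hx y hy
    rw [abs_le]; constructor <;> linarith [hx.1, hx.2, hy.1, hy.2]
  obtain ⟨T, hT⟩ : ∃ T, T = (U - L) ^ α := ⟨_, rfl⟩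
  have hT0 : 0 ≤ T := hT ▸ Real.rpow_nonneg hLU.le _
  have hΔ : U - L ≤ E * T := by
    calc U - L = (U - L) ^ (1 - α) * (U - L) ^ α := by
          rw [← Real.rpow_add hLU]; simp
      _ ≤ E * T := by
          rw [hT, hE]
          gcongr
  rw [← hT]
  obtain ⟨ξ1, k1, p1e⟩ := mvt_any h12 i1 i2 hd1'
  obtain ⟨ξ2, k2, p3e⟩ := mvt_any h23 i2 i3 hd1'
  obtain ⟨ξ3, k3, r3e⟩ := mvt_any h34 i3 i4 hd1'
  obtain ⟨ξ4, k4, r1e⟩ := mvt_any h14.symm i4 i1 hd1'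
  have b1 := hmle _ (hs k1)
  have b2 := hmle _ (hs k2)
  have b3 := hmle _ (hs k3)
  have b4 := hmle _ (hs k4)
  have n2 := hN _ (hs k2)
  generalize f' ξ1 = p1 at *
  generalize f' ξ2 = p3 at *
  generalize f' ξ3 = r3 at *
  generalize f' ξ4 = r1 at *
  obtain ⟨u, ku, eu⟩ := dd_diff (p := p1) (r := p3) h12 h23 h13 i1 i2 i3 hd1' hd2' p1e
    (by linear_combination -p3e)
  obtain ⟨v, kv, ev⟩ := dd_diff (p := r1) (r := r3) h14 h34.symm h13 i1 i4 i3 hd1' hd2'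
    (by linear_combination -r1e) r3e
  obtain ⟨w, kw, ew⟩ := dd_diff (p := r3) (r := p3) h34.symm h23.symm h24.symm i4 i3 i2 hd1' hd2'
    (by linear_combination -r3e) p3e
  have hp3 : 0 < p3 := by linarith
  have hr1 : 0 < r1 := by linarith
  have hcd : crossDist f x1 x2 x3 x4 - 1 = (p1 * r3 - p3 * r1) / (p3 * r1) := by
    unfold crossDist Cr
    rw [p1e, p3e, r3e, r1e]
    have s1 := sub_ne_zero.2 h12
    have s2 := sub_ne_zero.2 h23
    have s3 := sub_ne_zero.2 h34
    have s4 := sub_ne_zero.2 h14.symm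
    field_simp
  have hnum : p1 * r3 - p3 * r1 = (x1 - x3) *
      ((f'' u / 2) * ((x4 - x2) * (f'' w / 2)) + p3 * ((f'' u - f'' v) / 2)) := by
    linear_combination r3 * eu - p3 * ev + (x1 - x3) * (f'' u / 2) * ew
  have hb1 : |(f'' u / 2) * ((x4 - x2) * (f'' w / 2))| ≤ M * ((E * T) * M) := by
    rw [abs_mul, abs_mul]
    have a1 := hM _ (hs ku)
    have a2 := hM _ (hs kw)
    have a3 := (hdist _ i4 _ i2).trans hΔ
    have c1 : |f'' u / 2| ≤ M := by rw [abs_div, abs_two]; linarith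
    have c2 : |f'' w / 2| ≤ M := by rw [abs_div, abs_two]; linarith
    gcongr
  have hb2 : |p3 * ((f'' u - f'' v) / 2)| ≤ N * (H * T) := by
    rw [abs_mul]
    have a1 : |f'' u - f'' v| ≤ H * T := by
      refine (hHolder _ (hs ku) _ (hs kv)).trans ?_
      rw [hT]
      have := hdist _ ku _ kv
      gcongr
    have a2 : |(f'' u - f'' v) / 2| ≤ H * T := by
      rw [abs_div, abs_two]; linarith [abs_nonneg (f'' u - f'' v)]
    gcongr
  have hden : m ^ 2 ≤ p3 * r1 := by rw [sq]; gcongr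
  rw [hcd, hnum, abs_div, abs_of_pos (mul_pos hp3 hr1), abs_mul]
  calc _ ≤ |x1 - x3| * (M * ((E * T) * M) + N * (H * T)) / m ^ 2 := by
        gcongr
        exact (abs_add_le _ _).trans (add_le_add hb1 hb2)
    _ = (M * M * E + N * H) / m ^ 2 * |x1 - x3| * T := by ring
    _ ≤ _ := by
        gcongr
        linarith
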